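/- Global generator drift condition: for every α ∈ (1/4, 1/2), with β = 1 − 1/(4α), there exist constants K ≥ 0 and c* > 0 such that Σ_{i=1}^m Q_i(x) ≤ K − c* V_α(x)^β for every x ∈ Δ. (The left-hand side is the action of the infinitesimal generator of the energy-exchange process on V_α.) -/

import Mathlib

open MeasureTheory Set Filter

noncomputable section

/-- The open set `U ⊂ ℝ^m` with which the open simplex `Δ` is identified
(via `y = Ē - ∑ i, x i`). -/
def simU (m : ℕ) (E : ℝ) : Set (Fin m → ℝ) := {x | (∀ i, 0 < x i) ∧ ∑ i, x i < E}

/-- The state space `Δ`. -/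
abbrev Delta (m : ℕ) (E : ℝ) : Type := ↥(simU m E)

/-- The tank energy `y = Ē - ∑ i, x i`. -/
def tank (m : ℕ) (E : ℝ) (x : Delta m E) : ℝ := E - ∑ i, x.1 i

/-- The energy exchange map on the ambient space: particle `i` gets energy
`y + (1-u²) x^i`, and the new tank energy is `u² x^i`. -/
def T0 (m : ℕ) (E : ℝ) (i : Fin m) (u : ℝ) (x : Fin m → ℝ) : Fin m → ℝ :=
  Function.update x i ((E - ∑ j, x j) + (1 - u ^ 2) * x i)

lemma T0_mem {m : ℕ} {E : ℝ} {i : Fin m} {u : ℝ} {x : Fin m → ℝ}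
    (hx : x ∈ simU m E) (hu : u ∈ Ioo (0:ℝ) 1) : T0 m E i u x ∈ simU m E := by
  obtain ⟨hpos, hsum⟩ := hx
  obtain ⟨hu0, hu1⟩ := hu
  have hy : 0 < E - ∑ j, x j := sub_pos.mpr hsum
  have hu2 : 0 < 1 - u ^ 2 := by nlinarith
  have hxi := hpos i
  constructor
  · intro j
    rcases eq_or_ne j i with rfl | hj
    · simp only [T0, Function.update_self]
      nlinarith
    · simpa [T0, Function.update_of_ne hj] using hpos j
  · have h1 : ∑ j, T0 m E i u x j
        = ((E - ∑ j, x j) + (1 - u ^ 2) * x i) + ∑ j ∈ Finset.univ \ {i}, x j := by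
      simp only [T0]
      rw [Finset.sum_update_of_mem (Finset.mem_univ i)]
    have h2 : ∑ j ∈ Finset.univ \ {i}, x j = (∑ j, x j) - x i := by
      rw [← Finset.erase_eq]
      exact Finset.sum_erase_eq_sub (Finset.mem_univ i)
    rw [h1, h2]
    nlinarith [mul_pos (mul_pos hu0 hu0) hxi]

/-- The energy exchange map `T_{i,u} : Δ → Δ` (defined to be the identity for
`u ∉ (0,1)`, which is a probability-zero event). -/
def Texch (m : ℕ) (E : ℝ) (i : Fin m) (u : ℝ) (x : Delta m E) : Delta m E :=
  if hu : u ∈ Ioo (0:ℝ) 1 then ⟨T0 m E i u x.1, T0_mem x.2 hu⟩ else x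

/-- The uniform distribution on `(0,1)`. -/
def unif01 : Measure ℝ := volume.restrict (Ioo (0:ℝ) 1)

/-- The uniformization constant `Λ = √(m Ē)`, an upper bound for the total jump rate. -/
def Lam (m : ℕ) (E : ℝ) : ℝ := Real.sqrt (m * E)

/-- The total jump rate `∑ i, √(x^i)`. -/
def jumpRate (m : ℕ) (E : ℝ) (x : Delta m E) : ℝ := ∑ i, Real.sqrt (x.1 i)

/-- One step of the uniformized embedded chain: with probability `1 - r(x)/Λ` stay put,
and with probability `√(x^i)/Λ` particle `i` exchanges energy with the tank, with
`u` drawn uniformly from `(0,1)`. -/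
def ustep (m : ℕ) (E : ℝ) (x : Delta m E) : Measure (Delta m E) :=
  ENNReal.ofReal (1 - jumpRate m E x / Lam m E) • Measure.dirac x
  + (ENNReal.ofReal (Lam m E))⁻¹ •
      Measure.sum (fun i : Fin m =>
        ENNReal.ofReal (Real.sqrt (x.1 i)) • Measure.map (fun u => Texch m E i u x) unif01)

/-- `n`-fold iterate of the uniformized chain. -/
def ustepIter (m : ℕ) (E : ℝ) : ℕ → Delta m E → Measure (Delta m E)
  | 0 => fun x => Measure.dirac x
  | (n+1) => fun x => (ustep m E x).bind (ustepIter m E n)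

/-- The transition probabilities `P^t(x, ·)` of the energy-exchange jump process,
constructed by uniformization: `P^t = ∑ₙ e^{-Λt} (Λt)ⁿ/n! Kⁿ`. -/
def Pt (m : ℕ) (E : ℝ) (t : ℝ) (x : Delta m E) : Measure (Delta m E) :=
  Measure.sum (fun n : ℕ =>
    ENNReal.ofReal (Real.exp (-(Lam m E) * t) * ((Lam m E) * t) ^ n / n.factorial) •
      ustepIter m E n x)

/-- Lebesgue measure on `Δ ≅ U`. -/
def lebU (m : ℕ) (E : ℝ) : Measure (Delta m E) := Measure.comap Subtype.val volume

/-- The (unnormalized) measure with density `y^{-1/2}` w.r.t. Lebesgue measure on `U`. -/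
def piPre (m : ℕ) (E : ℝ) : Measure (Delta m E) :=
  (lebU m E).withDensity (fun x => ENNReal.ofReal ((tank m E x) ^ (-(1/2) : ℝ)))

/-- The invariant probability measure `π`, with density `Z⁻¹ y^{-1/2}`. -/
def piMeasure (m : ℕ) (E : ℝ) : Measure (Delta m E) :=
  (piPre m E Set.univ)⁻¹ • piPre m E

/-- Total variation distance between two (finite) measures:
`sup_A |μ(A) - ν(A)|`. -/
def tvDist {X : Type*} [MeasurableSpace X] (μ ν : Measure X) : ℝ :=
  ⨆ A : {A : Set X // MeasurableSet A}, |(μ A.1).toReal - (ν A.1).toReal|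

end

/-- The Lyapunov function `V_α(x) = ∑ i, (x^i)^{-2α} + y^{-α}`. -/
noncomputable def Vfun (m : ℕ) (E : ℝ) (α : ℝ) (x : Delta m E) : ℝ :=
  ∑ i, (x.1 i) ^ (-(2 * α)) + (tank m E x) ^ (-α)

/-- `Q_i(x) = √(x^i) ( ∫_0^1 [(x^i(1-u²)+y)^{-2α} + (x^i u²)^{-α}] du - (x^i)^{-2α} - y^{-α} )`. -/
noncomputable def Qi (m : ℕ) (E : ℝ) (α : ℝ) (i : Fin m) (x : Delta m E) : ℝ :=
  Real.sqrt (x.1 i) *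
    ((∫ u in (0:ℝ)..1,
        ((x.1 i * (1 - u ^ 2) + tank m E x) ^ (-(2 * α)) + (x.1 i * u ^ 2) ^ (-α)))
      - (x.1 i) ^ (-(2 * α)) - (tank m E x) ^ (-α))

/-- Integral bounds. -/
lemma aux_int {x y α : ℝ} (hx : 0 < x) (hy : 0 < y) (hα1 : 1/4 < α) (hα2 : α < 1/2) :
    (∫ u in (0:ℝ)..1, ((x * (1 - u ^ 2) + y) ^ (-(2 * α)) + (x * u ^ 2) ^ (-α)))
      ≤ min (x ^ (-(2*α)) / (1 - 2*α)) (y ^ (-(2*α))) + x ^ (-α) / (1 - 2*α) := by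
  have hbase : ∀ u ∈ Icc (0:ℝ) 1, y ≤ x * (1 - u ^ 2) + y := by
    intro u hu
    have : 0 ≤ 1 - u ^ 2 := by nlinarith [hu.1, hu.2]
    nlinarith [mul_nonneg hx.le this]
  have hi1 : IntervalIntegrable (fun u : ℝ => (x * (1 - u ^ 2) + y) ^ (-(2 * α))) volume 0 1 := by
    apply ContinuousOn.intervalIntegrable
    rw [uIcc_of_le zero_le_one]
    apply ContinuousOn.rpow_const
    · fun_prop
    · intro u hu
      left
      linarith [hbase u hu]
  have hpw : IntervalIntegrable (fun u : ℝ => u ^ (-(2 * α))) volume 0 1 :=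
    intervalIntegral.intervalIntegrable_rpow' (by linarith)
  have hpv : ∫ u in (0:ℝ)..1, u ^ (-(2 * α)) = 1 / (1 - 2*α) := by
    rw [integral_rpow (Or.inl (by linarith)), Real.one_rpow, Real.zero_rpow (by linarith)]
    congr 1
    · ring
    · ring
  have heq : ∀ u ∈ Icc (0:ℝ) 1, x ^ (-α) * u ^ (-(2 * α)) = (x * u ^ 2) ^ (-α) := by
    intro u hu
    rw [Real.mul_rpow hx.le (sq_nonneg u), ← Real.rpow_natCast u 2, ← Real.rpow_mul hu.1]
    congr 2
    push_cast; ring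
  have hi2 : IntervalIntegrable (fun u : ℝ => (x * u ^ 2) ^ (-α)) volume 0 1 := by
    apply (hpw.const_mul (x ^ (-α))).congr
    intro u hu
    rw [uIoc_of_le zero_le_one] at hu
    exact heq u ⟨hu.1.le, hu.2⟩
  have hv2 : ∫ u in (0:ℝ)..1, (x * u ^ 2) ^ (-α) = x ^ (-α) / (1 - 2*α) := by
    have : ∫ u in (0:ℝ)..1, (x * u ^ 2) ^ (-α) = ∫ u in (0:ℝ)..1, x ^ (-α) * u ^ (-(2 * α)) := by
      apply intervalIntegral.integral_congr
      intro u hu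
      rw [uIcc_of_le zero_le_one] at hu
      exact (heq u hu).symm
    rw [this, intervalIntegral.integral_const_mul, hpv]
    ring
  rw [intervalIntegral.integral_add hi1 hi2, hv2]
  gcongr
  apply le_min
  · have hpw' : IntervalIntegrable (fun u : ℝ => (1 - u) ^ (-(2 * α))) volume 0 1 := by
      have := (hpw.comp_sub_left 1).symm
      simpa using this
    have hpv' : ∫ u in (0:ℝ)..1, (1 - u) ^ (-(2 * α)) = 1 / (1 - 2*α) := by
      rw [intervalIntegral.integral_comp_sub_left (fun u : ℝ => u ^ (-(2 * α))) 1]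
      simpa using hpv
    have h := intervalIntegral.integral_mono_on_of_le_Ioo (zero_le_one) hi1
      (hpw'.const_mul (x ^ (-(2*α)))) (by
        intro u hu
        have h1 : 0 < 1 - u := by linarith [hu.2]
        rw [← Real.mul_rpow hx.le h1.le]
        apply Real.rpow_le_rpow_of_nonpos (by positivity) _ (by linarith)
        have : 1 - u ≤ 1 - u ^ 2 := by nlinarith [hu.1, hu.2]
        nlinarith [mul_le_mul_of_nonneg_left this hx.le])
    rw [intervalIntegral.integral_const_mul, hpv'] at h
    rw [div_eq_mul_one_div]
    exact h
  · have h := intervalIntegral.integral_mono_on_of_le_Ioo (zero_le_one) hi1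
      (intervalIntegrable_const (c := y ^ (-(2*α)))) (by
        intro u hu
        exact Real.rpow_le_rpow_of_nonpos hy (hbase u ⟨hu.1.le, hu.2.le⟩) (by linarith))
    simpa using h

lemma aux_Q {x y α E : ℝ} (hx : 0 < x) (hxE : x ≤ E) (hy : 0 < y) (hα1 : 1/4 < α)
    (hα2 : α < 1/2) :
    Real.sqrt x * ((∫ u in (0:ℝ)..1, ((x * (1 - u ^ 2) + y) ^ (-(2 * α)) + (x * u ^ 2) ^ (-α)))
      - x ^ (-(2 * α)) - y ^ (-α))
    ≤ 1 / (1 - 2*α) * y ^ (-(2*α - 1/2)) + E ^ (1/2 - α) / (1 - 2*α) - x ^ (-(2*α - 1/2))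
      - Real.sqrt x * y ^ (-α) := by
  have hB : 0 < 1 - 2*α := by linarith
  have hB1 : 1 ≤ 1 / (1 - 2*α) := by rw [le_div_iff₀ hB]; linarith
  have hs : ∀ z : ℝ, 0 < z → ∀ e : ℝ, Real.sqrt z * z ^ e = z ^ (1/2 + e) := by
    intro z hz e
    rw [Real.sqrt_eq_rpow, ← Real.rpow_add hz]
  have h1 := mul_le_mul_of_nonneg_left (aux_int hx hy hα1 hα2) (Real.sqrt_nonneg x)
  have h2 : Real.sqrt x * min (x ^ (-(2*α)) / (1 - 2*α)) (y ^ (-(2*α)))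
      ≤ 1 / (1 - 2*α) * y ^ (-(2*α - 1/2)) := by
    rcases le_total x y with h | h
    · calc _ ≤ Real.sqrt y * y ^ (-(2*α)) := by
            gcongr
            exact min_le_right _ _
        _ = y ^ (-(2*α - 1/2)) := by rw [hs y hy]; congr 1; ring
        _ ≤ _ := le_mul_of_one_le_left (by positivity) hB1
    · calc _ ≤ Real.sqrt x * (x ^ (-(2*α)) / (1 - 2*α)) := by
            gcongr
            exact min_le_left _ _
        _ = 1 / (1 - 2*α) * (Real.sqrt x * x ^ (-(2*α))) := by ring
        _ = 1 / (1 - 2*α) * x ^ (-(2*α - 1/2)) := by rw [hs x hx]; congr 2; ring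
        _ ≤ _ := by
            gcongr ?_ * ?_
            exact Real.rpow_le_rpow_of_nonpos hy h (by linarith)
  have h3 : Real.sqrt x * (x ^ (-α) / (1 - 2*α)) ≤ E ^ (1/2 - α) / (1 - 2*α) := by
    rw [← mul_div_assoc, hs x hx]
    gcongr
    exact Real.rpow_le_rpow hx.le hxE (by linarith)
  have h4 : Real.sqrt x * x ^ (-(2*α)) = x ^ (-(2*α - 1/2)) := by
    rw [hs x hx]; congr 1; ring
  rw [mul_sub, mul_sub, h4]
  rw [mul_add] at h1
  linarith

lemma aux_young {M a p α : ℝ} (hM : 0 < M) (ha : 0 < a) (hp : 0 < p) (hpα : p < α) :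
    ∃ C ≥ (0:ℝ), ∀ y > (0:ℝ), M * y ^ (-p) ≤ C + a * y ^ (-α) := by
  have hd : 0 < α - p := by linarith
  set δ := (a / M) ^ (1 / (α - p)) with hδ
  have hδ0 : 0 < δ := by positivity
  have hδe : δ ^ (α - p) = a / M := by
    rw [hδ, ← Real.rpow_mul (by positivity), one_div_mul_cancel hd.ne', Real.rpow_one]
  refine ⟨M * δ ^ (-p), by positivity, ?_⟩
  intro y hy
  rcases le_total y δ with h | h
  · have h1 : y ^ (-p) = y ^ (α - p) * y ^ (-α) := by
      rw [← Real.rpow_add hy]; congr 1; ring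
    have h2 : y ^ (α - p) ≤ a / M := by
      rw [← hδe]; exact Real.rpow_le_rpow hy.le h hd.le
    have h3 : M * y ^ (-p) ≤ a * y ^ (-α) := by
      calc M * y ^ (-p) ≤ M * (a / M * y ^ (-α)) := by rw [h1]; gcongr
        _ = _ := by field_simp
    have : 0 ≤ M * δ ^ (-p) := by positivity
    linarith
  · have h1 : M * y ^ (-p) ≤ M * δ ^ (-p) := by
      gcongr ?_ * ?_
      exact Real.rpow_le_rpow_of_nonpos hδ0 h (by linarith)
    have : 0 ≤ a * y ^ (-α) := by positivity
    linarith

lemma aux_sum_rpow {ι : Type*} (s : Finset ι) (f : ι → ℝ) (hf : ∀ i, 0 ≤ f i) {b : ℝ}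
    (hb : 0 < b) (hb1 : b ≤ 1) : (∑ i ∈ s, f i) ^ b ≤ ∑ i ∈ s, f i ^ b := by
  classical
  induction s using Finset.induction_on with
  | empty => simp [Real.zero_rpow hb.ne']
  | insert i s hi ih =>
    rw [Finset.sum_insert hi, Finset.sum_insert hi]
    have := Real.rpow_add_le_add_rpow (hf i) (Finset.sum_nonneg (s := s) fun j _ => hf j) hb.le hb1
    linarith

/-- global generator drift condition. For every `α ∈ (1/4, 1/2)`,
with `β = 1 - 1/(4α)`, there are `K ≥ 0` and `c* > 0` such that
`∑ i, Q_i(x) ≤ K - c* V_α(x)^β` for every `x ∈ Δ` (the left-hand side being the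
action of the generator of the energy-exchange process on `V_α`). -/
theorem generator_drift (m : ℕ) (hm : 1 ≤ m) (E : ℝ) (hE : 0 < E)
    (α : ℝ) (hα1 : 1/4 < α) (hα2 : α < 1/2) :
    ∃ K ≥ (0:ℝ), ∃ cstar > (0:ℝ), ∀ x : Delta m E,
      ∑ i, Qi m E α i x ≤ K - cstar * (Vfun m E α x) ^ (1 - 1 / (4 * α)) := by
  have hα : 0 < α := by linarith
  have hm' : (0:ℝ) < m := by exact_mod_cast hm
  have hB : 0 < 1 - 2*α := by linarith
  set p := 2*α - 1/2 with hp
  have hp0 : 0 < p := by rw [hp]; linarith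
  have hpα : p < α := by rw [hp]; linarith
  set a := Real.sqrt (E/2) with ha
  have ha0 : 0 < a := by rw [ha]; positivity
  obtain ⟨C, hC, hyoung⟩ := aux_young (M := m * (1 / (1 - 2*α))) (a := a/2) (by positivity)
    (by positivity) hp0 hpα
  set β := 1 - 1 / (4 * α) with hβ
  have hβ0 : 0 < β := by
    rw [hβ, sub_pos, div_lt_one (by positivity)]; linarith
  have hβ1 : β ≤ 1 := by
    have : 0 < 1 / (4 * α) := by positivity
    rw [hβ]; linarith
  have hβp : -(2*α) * β = -p := by
    rw [hβ, hp]; field_simp; ring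
  set c := min 1 (a/2) with hc
  have hc0 : 0 < c := lt_min one_pos (by positivity)
  have hc1 : c ≤ 1 := min_le_left _ _
  have hc2 : c ≤ a/2 := min_le_right _ _
  refine ⟨C + m * (E ^ (1/2 - α) / (1 - 2*α)) + a * (E/2) ^ (-α) + 1, by positivity, c, hc0, ?_⟩
  intro x
  have hx : ∀ i, 0 < x.1 i := x.2.1
  have hy : 0 < tank m E x := sub_pos.mpr x.2.2
  have hsum : ∑ i, x.1 i = E - tank m E x := by simp [tank]
  have hV : Vfun m E α x = ∑ i, (x.1 i) ^ (-(2 * α)) + (tank m E x) ^ (-α) := rfl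
  have hQ : ∀ i, Qi m E α i x ≤ 1 / (1 - 2*α) * (tank m E x) ^ (-p) + E ^ (1/2 - α) / (1 - 2*α)
      - (x.1 i) ^ (-p) - Real.sqrt (x.1 i) * (tank m E x) ^ (-α) := by
    intro i
    refine aux_Q (hx i) ?_ hy hα1 hα2
    exact (Finset.single_le_sum (f := x.1) (fun j _ => (hx j).le) (Finset.mem_univ i)).trans x.2.2.le
  generalize tank m E x = y at *
  have hS := Finset.sum_le_sum (s := Finset.univ) fun i _ => hQ i
  rw [Finset.sum_sub_distrib, Finset.sum_sub_distrib, ← Finset.sum_mul] at hS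
  simp only [Finset.sum_const, Finset.card_univ, Fintype.card_fin, nsmul_eq_mul] at hS
  have hsq : Real.sqrt (E - y) ≤ ∑ i, Real.sqrt (x.1 i) := by
    rw [← hsum]
    simp only [Real.sqrt_eq_rpow]
    exact aux_sum_rpow _ _ (fun i => (hx i).le) (by norm_num) (by norm_num)
  have hya : 0 < y ^ (-α) := by positivity
  have hdr : a * y ^ (-α) ≤ (∑ i, Real.sqrt (x.1 i)) * y ^ (-α) + a * (E/2) ^ (-α) := by
    rcases le_total y (E/2) with h | h
    · have h1 : a ≤ ∑ i, Real.sqrt (x.1 i) :=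
        (Real.sqrt_le_sqrt (by linarith)).trans hsq
      have h2 := mul_le_mul_of_nonneg_right h1 hya.le
      have h3 : 0 ≤ a * (E/2) ^ (-α) := by positivity
      linarith
    · have h1 : a * y ^ (-α) ≤ a * (E/2) ^ (-α) := by
        gcongr ?_ * ?_
        exact Real.rpow_le_rpow_of_nonpos (by positivity) h (by linarith)
      have h2 : 0 ≤ (∑ i, Real.sqrt (x.1 i)) * y ^ (-α) :=
        mul_nonneg (Finset.sum_nonneg fun i _ => Real.sqrt_nonneg _) hya.le
      linarith
  have hY := hyoung y hy
  have hsx : 0 ≤ ∑ i, (x.1 i) ^ (-p) := Finset.sum_nonneg fun i _ => (Real.rpow_pos_of_pos (hx i) _).le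
  have hVb : (Vfun m E α x) ^ β ≤ ∑ i, (x.1 i) ^ (-p) + (1 + y ^ (-α)) := by
    rw [hV]
    have hnn : ∀ i, 0 ≤ (x.1 i) ^ (-(2*α)) := fun i => (Real.rpow_pos_of_pos (hx i) _).le
    refine (Real.rpow_add_le_add_rpow (Finset.sum_nonneg fun i _ => hnn i) hya.le hβ0.le hβ1).trans ?_
    apply add_le_add
    · refine (aux_sum_rpow _ _ hnn hβ0 hβ1).trans (le_of_eq ?_)
      refine Finset.sum_congr rfl fun i _ => ?_
      rw [← Real.rpow_mul (hx i).le, hβp]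
    · rcases le_total (y ^ (-α)) 1 with h | h
      · have := Real.rpow_le_one hya.le h hβ0.le
        linarith
      · have := Real.rpow_le_rpow_of_exponent_le h hβ1
        rw [Real.rpow_one] at this
        linarith
  have h5 := mul_le_mul_of_nonneg_left hVb hc0.le
  have h6 := mul_le_mul_of_nonneg_right hc1 hsx
  have h7 := mul_le_mul_of_nonneg_right hc2 hya.le
  rw [mul_add, mul_add] at h5
  rw [mul_add, ← mul_assoc] at hS
  linarith
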